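/- arXiv:0712.3015 — 5 statements merged into one kernel-verified Lean document; each statement's English description precedes it below -/
import Mathlib

section
/- Let G be a polynomial extension of Q by H (with respect to a section σ), and let ℓ be the word-length function on G associated to the generating set ι(A) ∪ σ(𝒬). Then for every h ∈ H one has ℓ(ι(h)) ≤ ℓ_H(h), and there exist constants C > 0 and r > 0 such that ℓ_H(h) ≤ C·(1 + ℓ(ι(h)))^r for all h ∈ H. In particular the word-length of H is polynomially equivalent to the restriction to H of the word-length of G. -/
/-- The word-length function associated to a generating set `S` of a group. -/
noncomputable def wordLength {G : Type*} [Group G] (S : Set G) (g : G) : ℕ :=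
  sInf {n | ∃ w : List G, w.length = n ∧ (∀ x ∈ w, x ∈ S ∨ x⁻¹ ∈ S) ∧ w.prod = g}


lemma wordLength_le_of_list {G : Type*} [Group G] {S : Set G} (w : List G)
    (hw : ∀ x ∈ w, x ∈ S ∨ x⁻¹ ∈ S) : wordLength S w.prod ≤ w.length :=
  Nat.sInf_le ⟨w, rfl, hw, rfl⟩

lemma exists_word_of_list {G : Type*} [Group G] {S : Set G} (w : List G)
    (hw : ∀ x ∈ w, x ∈ S ∨ x⁻¹ ∈ S) :
    ∃ v : List G, v.length = wordLength S w.prod ∧ (∀ x ∈ v, x ∈ S ∨ x⁻¹ ∈ S) ∧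
      v.prod = w.prod :=
  Nat.sInf_mem (s := {n | ∃ v : List G, v.length = n ∧ (∀ x ∈ v, x ∈ S ∨ x⁻¹ ∈ S) ∧
    v.prod = w.prod}) ⟨w.length, w, rfl, hw, rfl⟩

lemma exists_word_of_closure {G : Type*} [Group G] {S : Set G}
    (hS : Subgroup.closure S = ⊤) (g : G) :
    ∃ v : List G, v.length = wordLength S g ∧ (∀ x ∈ v, x ∈ S ∨ x⁻¹ ∈ S) ∧ v.prod = g := by
  have hg : g ∈ (Subgroup.closure S).toSubmonoid := by rw [hS]; trivial
  rw [Subgroup.closure_toSubmonoid] at hg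
  obtain ⟨w, hw, rfl⟩ := Submonoid.exists_list_of_mem_closure hg
  exact exists_word_of_list w hw

lemma wordLength_mul_le' {G : Type*} [Group G] {S : Set G}
    (hS : Subgroup.closure S = ⊤) (g h : G) :
    wordLength S (g * h) ≤ wordLength S g + wordLength S h := by
  obtain ⟨v, hv, hv1, hv2⟩ := exists_word_of_closure hS g
  obtain ⟨w, hw, hw1, hw2⟩ := exists_word_of_closure hS h
  have := wordLength_le_of_list (S := S) (v ++ w) (by
    intro x hx
    rcases List.mem_append.1 hx with hx | hx
    · exact hv1 x hx
    · exact hw1 x hx)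
  rwa [List.prod_append, List.length_append, hv2, hw2, hv, hw] at this

lemma wordLength_inv_le' {G : Type*} [Group G] {S : Set G}
    (hS : Subgroup.closure S = ⊤) (g : G) :
    wordLength S g⁻¹ ≤ wordLength S g := by
  obtain ⟨v, hv, hv1, hv2⟩ := exists_word_of_closure hS g
  have := wordLength_le_of_list (S := S) (v.map (fun x => x⁻¹)).reverse (by
    intro x hx
    rw [List.mem_reverse, List.mem_map] at hx
    obtain ⟨y, hy, rfl⟩ := hx
    rw [inv_inv]
    exact (hv1 y hy).symm)
  rw [← List.prod_inv_reverse, hv2] at this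
  simpa [hv] using this

lemma wordLength_gen_le {G : Type*} [Group G] {S : Set G} (g : G)
    (hg : g ∈ S ∨ g⁻¹ ∈ S) : wordLength S g ≤ 1 := by
  have := wordLength_le_of_list (S := S) [g] (by simpa using hg)
  simpa using this

lemma wordLength_one_eq {G : Type*} [Group G] (S : Set G) : wordLength S (1 : G) = 0 := by
  have := wordLength_le_of_list (S := S) [] (by simp)
  simpa using this

/-- For a polynomial extension `1 → H → G → Q → 1`, the word-length of `H` is
polynomially equivalent to the restriction to `H` of the word-length of `G`
(associated to the generating set `ι(A) ∪ σ(𝒬)`). -/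
theorem wordLength_poly_equiv_restriction
    {H G Q : Type*} [Group H] [Group G] [Group Q]
    (ι : H →* G) (π : G →* Q)
    (hι : Function.Injective ι) (hπ : Function.Surjective π)
    (hexact : ι.range = π.ker)
    (σ : Q → G) (hσ : ∀ q, π (σ q) = q)
    (A : Finset H) (hA : Subgroup.closure (A : Set H) = ⊤)
    (𝒬 : Finset Q) (h𝒬 : Subgroup.closure (𝒬 : Set Q) = ⊤)
    (fs : Q → Q → H)
    (hfs : ∀ q₁ q₂, σ q₁ * σ q₂ = σ (q₁ * q₂) * ι (fs q₁ q₂))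
    (conj : H → Q → H)
    (hconj : ∀ (h : H) (q : Q), ι (conj h q) = (σ q)⁻¹ * ι h * σ q)
    (C₀ r₀ : ℝ) (hC₀ : 0 < C₀) (hr₀ : 0 < r₀)
    (hfs_poly : ∀ q₁ q₂ : Q,
      (wordLength (A : Set H) (fs q₁ q₂) : ℝ) ≤
        C₀ * ((1 + (wordLength (𝒬 : Set Q) q₁ : ℝ)) *
              (1 + (wordLength (𝒬 : Set Q) q₂ : ℝ))) ^ r₀)
    (hconj_poly : ∀ (h : H) (q : Q),
      (wordLength (A : Set H) (conj h q) : ℝ) ≤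
        C₀ * (wordLength (A : Set H) h : ℝ) *
          (1 + (wordLength (𝒬 : Set Q) q : ℝ)) ^ r₀) :
    (∀ h : H,
      wordLength (ι '' (A : Set H) ∪ σ '' (𝒬 : Set Q)) (ι h) ≤ wordLength (A : Set H) h) ∧
    ∃ C r : ℝ, 0 < C ∧ 0 < r ∧ ∀ h : H,
      (wordLength (A : Set H) h : ℝ) ≤
        C * (1 + (wordLength (ι '' (A : Set H) ∪ σ '' (𝒬 : Set Q)) (ι h) : ℝ)) ^ r := by
  have hwimg : ∀ w : List H, (∀ x ∈ w, x ∈ (A : Set H) ∨ x⁻¹ ∈ (A : Set H)) →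
      ∀ y ∈ w.map ι, y ∈ (ι '' (A : Set H) ∪ σ '' (𝒬 : Set Q)) ∨
        y⁻¹ ∈ (ι '' (A : Set H) ∪ σ '' (𝒬 : Set Q)) := by
    intro w hw y hy
    obtain ⟨x, hx, rfl⟩ := List.mem_map.1 hy
    rcases hw x hx with h | h
    · exact Or.inl (Or.inl ⟨x, h, rfl⟩)
    · exact Or.inr (Or.inl ⟨x⁻¹, h, map_inv ι x⟩)
  refine ⟨?_, 2 * C₀ * 2 ^ r₀, r₀ + 1, by positivity, by positivity, ?_⟩
  · intro h
    obtain ⟨w, hw, hw1, rfl⟩ := exists_word_of_closure hA h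
    have := wordLength_le_of_list _ (hwimg w hw1)
    rw [← map_list_prod, List.length_map, hw] at this
    exact this
  have hσ1 : σ 1 = ι (fs 1 1) := by
    have := hfs 1 1
    rw [mul_one] at this
    exact mul_left_cancel this
  have hfs11 : (wordLength (A : Set H) (fs 1 1) : ℝ) ≤ C₀ := by
    have := hfs_poly 1 1
    simpa [wordLength_one_eq] using this
  -- bounds on the factor set and the conjugation
  have hfsb : ∀ (N : ℕ) (s q : Q), wordLength (𝒬 : Set Q) s ≤ 1 →
      wordLength (𝒬 : Set Q) q ≤ N →
      (wordLength (A : Set H) (fs s q) : ℝ) ≤ C₀ * (2 * (1 + (N : ℝ))) ^ r₀ := by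
    intro N s q hs hq
    refine (hfs_poly s q).trans ?_
    have hs' : (wordLength (𝒬 : Set Q) s : ℝ) ≤ 1 := by exact_mod_cast hs
    have hq' : (wordLength (𝒬 : Set Q) q : ℝ) ≤ N := by exact_mod_cast hq
    gcongr
    linarith
  have hcb : ∀ (N : ℕ) (a : H) (q : Q), wordLength (A : Set H) a ≤ 1 →
      wordLength (𝒬 : Set Q) q ≤ N →
      (wordLength (A : Set H) (conj a q) : ℝ) ≤ C₀ * (2 * (1 + (N : ℝ))) ^ r₀ := by
    intro N a q ha hq
    refine (hconj_poly a q).trans ?_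
    have ha' : (wordLength (A : Set H) a : ℝ) ≤ 1 := by exact_mod_cast ha
    have hq' : (wordLength (𝒬 : Set Q) q : ℝ) ≤ N := by exact_mod_cast hq
    have h1 : (1 + (wordLength (𝒬 : Set Q) q : ℝ)) ^ r₀ ≤ (2 * (1 + (N : ℝ))) ^ r₀ := by
      apply Real.rpow_le_rpow (by positivity) _ hr₀.le
      have : (0 : ℝ) ≤ N := by positivity
      linarith
    calc C₀ * (wordLength (A : Set H) a : ℝ) * (1 + (wordLength (𝒬 : Set Q) q : ℝ)) ^ r₀
        ≤ C₀ * 1 * (2 * (1 + (N : ℝ))) ^ r₀ := by gcongr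
      _ = _ := by ring
  have hπι : ∀ a, π (ι a) = 1 := by
    intro a
    have : ι a ∈ π.ker := hexact ▸ ⟨a, rfl⟩
    exact this
  have key : ∀ (N : ℕ) (w : List G), w.length ≤ N →
      (∀ x ∈ w, x ∈ (ι '' (A : Set H) ∪ σ '' (𝒬 : Set Q)) ∨
        x⁻¹ ∈ (ι '' (A : Set H) ∪ σ '' (𝒬 : Set Q))) →
      ∃ (q : Q) (k : H), w.prod = σ q * ι k ∧ wordLength (𝒬 : Set Q) q ≤ w.length ∧
        (wordLength (A : Set H) k : ℝ) ≤
          C₀ + w.length * (C₀ * (2 * (1 + (N : ℝ))) ^ r₀) := by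
    intro N w
    induction w with
    | nil =>
      intro _ _
      refine ⟨1, (fs 1 1)⁻¹, by simp [hσ1], by simp [wordLength_one_eq], ?_⟩
      have : (wordLength (A : Set H) (fs 1 1)⁻¹ : ℝ) ≤ wordLength (A : Set H) (fs 1 1) := by
        exact_mod_cast wordLength_inv_le' hA _
      simp only [List.length_nil, Nat.cast_zero, zero_mul, add_zero]
      linarith
    | cons x w ih =>
      intro hN hw
      rw [List.length_cons] at hN
      obtain ⟨q, k, hqk, hq, hk⟩ := ih (by omega) (fun y hy => hw y (List.mem_cons_of_mem _ hy))
      -- it suffices to rewrite `x * σ q`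
      suffices hs : ∃ (q' : Q) (c : H), x * σ q = σ q' * ι c ∧
          wordLength (𝒬 : Set Q) q' ≤ w.length + 1 ∧
          (wordLength (A : Set H) c : ℝ) ≤ C₀ * (2 * (1 + (N : ℝ))) ^ r₀ by
        obtain ⟨q', c, h1, h2, h3⟩ := hs
        refine ⟨q', c * k, ?_, by simpa using h2, ?_⟩
        · rw [List.prod_cons, hqk, ← mul_assoc, h1, map_mul, mul_assoc]
        · have : (wordLength (A : Set H) (c * k) : ℝ) ≤
              wordLength (A : Set H) c + wordLength (A : Set H) k := by
            exact_mod_cast wordLength_mul_le' hA _ _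
          rw [List.length_cons]
          push_cast
          linarith
      have hι' : ∀ a : H, x = ι a → wordLength (A : Set H) a ≤ 1 →
          ∃ (q' : Q) (c : H), x * σ q = σ q' * ι c ∧
          wordLength (𝒬 : Set Q) q' ≤ w.length + 1 ∧
          (wordLength (A : Set H) c : ℝ) ≤ C₀ * (2 * (1 + (N : ℝ))) ^ r₀ := by
        intro a hxa ha
        refine ⟨q, conj a q, ?_, by omega, hcb N a q ha (by omega)⟩
        rw [hconj, hxa]
        group
      rcases hw x List.mem_cons_self with (⟨a, ha, hax⟩ | ⟨s, hs, hsx⟩) | (⟨a, ha, hax⟩ | ⟨s, hs, hsx⟩)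
      · exact hι' a hax.symm (wordLength_gen_le a (Or.inl ha))
      · have hs1 := wordLength_gen_le (S := (𝒬 : Set Q)) s (Or.inl hs)
        refine ⟨s * q, fs s q, by rw [← hsx, hfs], ?_, hfsb N s q hs1 (by omega)⟩
        have := wordLength_mul_le' h𝒬 s q
        omega
      · exact hι' a⁻¹ (by rw [map_inv, hax, inv_inv])
          (wordLength_gen_le a⁻¹ (Or.inr (by rwa [inv_inv])))
      · have hs1 := wordLength_gen_le (S := (𝒬 : Set Q)) s (Or.inl hs)
        have hs2 := wordLength_inv_le' h𝒬 s
        have hs3 := wordLength_mul_le' h𝒬 s⁻¹ q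
        refine ⟨s⁻¹ * q, (fs s (s⁻¹ * q))⁻¹, ?_, by omega, ?_⟩
        · have := hfs s (s⁻¹ * q)
          rw [mul_inv_cancel_left] at this
          rw [map_inv, eq_mul_inv_iff_mul_eq, mul_assoc, ← this, hsx, mul_inv_cancel_left]
        · have h4 : (wordLength (A : Set H) (fs s (s⁻¹ * q))⁻¹ : ℝ) ≤
              wordLength (A : Set H) (fs s (s⁻¹ * q)) := by
            exact_mod_cast wordLength_inv_le' hA _
          exact h4.trans (hfsb N s _ hs1 (by omega))
  intro h
  obtain ⟨w₀, -, hw₀, rfl⟩ := exists_word_of_closure hA h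
  obtain ⟨v, hv, hv1, hv2⟩ := exists_word_of_list _ (hwimg w₀ hw₀)
  rw [← map_list_prod] at hv hv2
  generalize w₀.prod = h at *
  obtain ⟨q, k, hqk, -, hk⟩ := key v.length v le_rfl hv1
  rw [hv2] at hqk
  have hq : q = 1 := by
    have := congrArg π hqk
    rw [map_mul, hσ, hπι, hπι, mul_one] at this
    exact this.symm
  rw [hq, hσ1, ← map_mul] at hqk
  have hh := hι hqk
  rw [hv] at hk
  generalize wordLength (ι '' (A : Set H) ∪ σ '' (𝒬 : Set Q)) (ι h) = N at *
  have h5 : (wordLength (A : Set H) h : ℝ) ≤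
      wordLength (A : Set H) (fs 1 1) + wordLength (A : Set H) k := by
    rw [hh]
    exact_mod_cast wordLength_mul_le' hA _ _
  have hN : (0 : ℝ) ≤ N := by positivity
  have h6 : C₀ ≤ C₀ * (2 * (1 + (N : ℝ))) ^ r₀ :=
    le_mul_of_one_le_right hC₀.le (Real.one_le_rpow (by linarith) hr₀.le)
  have h7 : 2 * C₀ * 2 ^ r₀ * (1 + (N : ℝ)) ^ (r₀ + 1) =
      2 * (1 + (N : ℝ)) * (C₀ * (2 * (1 + (N : ℝ))) ^ r₀) := by
    rw [Real.rpow_add (by positivity), Real.rpow_one,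
      Real.mul_rpow (by norm_num) (by positivity)]
    ring
  rw [h7]
  have h8 : 0 ≤ (N : ℝ) * (C₀ * (2 * (1 + (N : ℝ))) ^ r₀) := by positivity
  linarith
end

section
/- Let G be a polynomial extension of Q by H (with respect to a section σ), and let ℓ be the word-length function on G associated to the generating set ι(A) ∪ σ(𝒬). Then for every function f : H → ℂ the following are equivalent: (i) for every k ∈ ℕ, Σ_{h∈H} |f(h)|·(1+ℓ_H(h))^k < ∞; (ii) for every k ∈ ℕ, Σ_{h∈H} |f(h)|·(1+ℓ(ι(h)))^k < ∞. That is, the Schwartz space of H formed with ℓ_H coincides with the one formed with the restriction of ℓ to H. -/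
theorem wl_le {G : Type*} [Group G] (S : Set G) (w : List G)
    (hw : ∀ x ∈ w, x ∈ S ∨ x⁻¹ ∈ S) : wordLength S w.prod ≤ w.length :=
  Nat.sInf_le ⟨w, rfl, hw, rfl⟩

theorem wl_attained {G : Type*} [Group G] (S : Set G) (w : List G)
    (hw : ∀ x ∈ w, x ∈ S ∨ x⁻¹ ∈ S) :
    ∃ v : List G, v.length = wordLength S w.prod ∧ (∀ x ∈ v, x ∈ S ∨ x⁻¹ ∈ S) ∧
      v.prod = w.prod :=
  Nat.sInf_mem (s := {n | ∃ v : List G, v.length = n ∧ (∀ x ∈ v, x ∈ S ∨ x⁻¹ ∈ S) ∧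
    v.prod = w.prod}) ⟨w.length, w, rfl, hw, rfl⟩

theorem wl_exists {G : Type*} [Group G] (S : Set G) (hS : Subgroup.closure S = ⊤) (g : G) :
    ∃ v : List G, v.length = wordLength S g ∧ (∀ x ∈ v, x ∈ S ∨ x⁻¹ ∈ S) ∧ v.prod = g := by
  have hg : g ∈ Subgroup.closure S := by rw [hS]; trivial
  rw [← Subgroup.mem_toSubmonoid, Subgroup.closure_toSubmonoid] at hg
  obtain ⟨w, hw, rfl⟩ := Submonoid.exists_list_of_mem_closure hg
  exact wl_attained S w (fun x hx => by simpa using hw x hx)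

theorem wl_mul {G : Type*} [Group G] (S : Set G) (hS : Subgroup.closure S = ⊤) (g h : G) :
    wordLength S (g * h) ≤ wordLength S g + wordLength S h := by
  obtain ⟨v, hv, hv2, hv3⟩ := wl_exists S hS g
  obtain ⟨w, hw, hw2, hw3⟩ := wl_exists S hS h
  have := wl_le S (v ++ w) (by
    intro x hx
    rcases List.mem_append.1 hx with hx | hx
    · exact hv2 x hx
    · exact hw2 x hx)
  rw [List.prod_append, List.length_append, hv3, hw3, hv, hw] at this
  exact this

theorem wl_inv {G : Type*} [Group G] (S : Set G) (hS : Subgroup.closure S = ⊤) (g : G) :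
    wordLength S g⁻¹ ≤ wordLength S g := by
  obtain ⟨v, hv, hv2, hv3⟩ := wl_exists S hS g
  have := wl_le S (v.map (·⁻¹)).reverse (by
    intro x hx
    simp only [List.mem_reverse, List.mem_map] at hx
    obtain ⟨y, hy, rfl⟩ := hx
    rw [inv_inv]
    exact (hv2 y hy).symm)
  rw [← List.prod_inv_reverse, hv3] at this
  simpa [hv] using this

theorem wl_gen {G : Type*} [Group G] (S : Set G) (g : G) (hg : g ∈ S ∨ g⁻¹ ∈ S) :
    wordLength S g ≤ 1 := by
  have := wl_le S [g] (by simpa using hg)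
  simpa using this

theorem schwartz_dom {H : Type*} (f : H → ℂ) (a b : H → ℕ) (K : ℝ) (M : ℕ)
    (hab : ∀ h, 1 + (a h : ℝ) ≤ K * (1 + (b h : ℝ)) ^ M)
    (hs : ∀ k : ℕ, Summable fun h : H => ‖f h‖ * (1 + (b h : ℝ)) ^ k) (k : ℕ) :
    Summable fun h : H => ‖f h‖ * (1 + (a h : ℝ)) ^ k := by
  refine Summable.of_nonneg_of_le (fun h => by positivity) (fun h => ?_)
    ((hs (M * k)).mul_left (K ^ k))
  calc ‖f h‖ * (1 + (a h : ℝ)) ^ k ≤ ‖f h‖ * (K * (1 + (b h : ℝ)) ^ M) ^ k := by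
        gcongr; exact hab h
    _ = K ^ k * (‖f h‖ * (1 + (b h : ℝ)) ^ (M * k)) := by rw [mul_pow, ← pow_mul]; ring

theorem word_normal_form
    {H G Q : Type*} [Group H] [Group G] [Group Q]
    (ι : H →* G) (σ : Q → G)
    (A : Finset H) (hA : Subgroup.closure (A : Set H) = ⊤)
    (𝒬 : Finset Q) (h𝒬 : Subgroup.closure (𝒬 : Set Q) = ⊤)
    (fs : Q → Q → H)
    (hfs : ∀ q₁ q₂, σ q₁ * σ q₂ = σ (q₁ * q₂) * ι (fs q₁ q₂))
    (conj : H → Q → H)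
    (hconj : ∀ (h : H) (q : Q), ι (conj h q) = (σ q)⁻¹ * ι h * σ q)
    (C₀ r₀ : ℝ) (hC₀ : 0 < C₀) (hr₀ : 0 < r₀)
    (hfs_poly : ∀ q₁ q₂ : Q,
      (wordLength (A : Set H) (fs q₁ q₂) : ℝ) ≤
        C₀ * ((1 + (wordLength (𝒬 : Set Q) q₁ : ℝ)) *
              (1 + (wordLength (𝒬 : Set Q) q₂ : ℝ))) ^ r₀)
    (hconj_poly : ∀ (h : H) (q : Q),
      (wordLength (A : Set H) (conj h q) : ℝ) ≤
        C₀ * (wordLength (A : Set H) h : ℝ) *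
          (1 + (wordLength (𝒬 : Set Q) q : ℝ)) ^ r₀) (N : ℕ) (w : List G)
    (hw : ∀ x ∈ w, x ∈ ι '' (A : Set H) ∪ σ '' (𝒬 : Set Q) ∨
      x⁻¹ ∈ ι '' (A : Set H) ∪ σ '' (𝒬 : Set Q)) (hN : w.length ≤ N) :
    ∃ q h, w.prod = σ q * ι h ∧ wordLength (𝒬 : Set Q) q ≤ w.length ∧
      (wordLength (A : Set H) h : ℝ) ≤ wordLength (A : Set H) (fs 1 1)
        + w.length * (C₀ * (2 * (1 + (N : ℝ))) ^ r₀) := by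
  have hσ1 : σ 1 = ι (fs 1 1) := by
    have := hfs 1 1
    rw [mul_one] at this
    exact mul_left_cancel this
  induction w with
  | nil =>
    refine ⟨1, (fs 1 1)⁻¹, ?_, ?_, ?_⟩
    · simp [hσ1]
    · simpa using wl_le (𝒬 : Set Q) [] (by simp)
    · simpa using wl_inv _ hA (fs 1 1)
  | cons x w ih =>
    have hlen : w.length + 1 ≤ N := by simpa using hN
    obtain ⟨q, h, hprod, hq, hh⟩ := ih (fun y hy => hw y (List.mem_cons_of_mem _ hy)) (by omega)
    -- it suffices to move the letter past `σ q`
    suffices hs : ∃ q' c, x * σ q = σ q' * ι c ∧ wordLength (𝒬 : Set Q) q' ≤ w.length + 1 ∧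
        (wordLength (A : Set H) c : ℝ) ≤ C₀ * (2 * (1 + (N : ℝ))) ^ r₀ by
      obtain ⟨q', c, h1, h2, h3⟩ := hs
      refine ⟨q', c * h, ?_, by simpa using h2, ?_⟩
      · rw [List.prod_cons, hprod, ← mul_assoc, h1, map_mul, mul_assoc]
      · have h4 : (wordLength (A : Set H) (c * h) : ℝ) ≤
            wordLength (A : Set H) c + wordLength (A : Set H) h := by
          exact_mod_cast wl_mul _ hA c h
        rw [List.length_cons]
        push_cast
        linarith
    have hfsb : ∀ s q : Q, wordLength (𝒬 : Set Q) s ≤ 1 → wordLength (𝒬 : Set Q) q ≤ N →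
        (wordLength (A : Set H) (fs s q) : ℝ) ≤ C₀ * (2 * (1 + (N : ℝ))) ^ r₀ := by
      intro s q hs hq
      refine (hfs_poly s q).trans ?_
      have h1 : (wordLength (𝒬 : Set Q) s : ℝ) ≤ 1 := by exact_mod_cast hs
      have h2 : (wordLength (𝒬 : Set Q) q : ℝ) ≤ N := by exact_mod_cast hq
      gcongr
      linarith
    have hH : ∀ a : H, wordLength (A : Set H) a ≤ 1 → ∃ q' c, ι a * σ q = σ q' * ι c ∧
        wordLength (𝒬 : Set Q) q' ≤ w.length + 1 ∧
        (wordLength (A : Set H) c : ℝ) ≤ C₀ * (2 * (1 + (N : ℝ))) ^ r₀ := by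
      intro a ha
      refine ⟨q, conj a q, ?_, by omega, ?_⟩
      · rw [hconj]; group
      · refine (hconj_poly a q).trans ?_
        have h1 : (wordLength (A : Set H) a : ℝ) ≤ 1 := by exact_mod_cast ha
        have h2 : (wordLength (𝒬 : Set Q) q : ℝ) ≤ N := by
          have : wordLength (𝒬 : Set Q) q ≤ N := by omega
          exact_mod_cast this
        calc C₀ * (wordLength (A : Set H) a : ℝ) * (1 + (wordLength (𝒬 : Set Q) q : ℝ)) ^ r₀
            ≤ C₀ * 1 * (2 * (1 + (N : ℝ))) ^ r₀ := by
              gcongr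
              linarith [(Nat.cast_nonneg N : (0 : ℝ) ≤ N)]
          _ = _ := by rw [mul_one]
    rcases hw x List.mem_cons_self with (⟨a, ha, rfl⟩ | ⟨s, hs, rfl⟩) | (⟨a, ha, hax⟩ | ⟨s, hs, hsx⟩)
    · exact hH a (wl_gen _ a (Or.inl ha))
    · have h1 := wl_gen (𝒬 : Set Q) s (Or.inl hs)
      have h2 := wl_mul _ h𝒬 s q
      exact ⟨s * q, fs s q, hfs s q, by omega, hfsb s q h1 (by omega)⟩
    · have hx : x = ι a⁻¹ := by rw [map_inv, hax, inv_inv]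
      rw [hx]
      exact hH a⁻¹ (wl_gen _ a⁻¹ (Or.inr (by simpa using ha)))
    · have hx : x = (σ s)⁻¹ := by rw [hsx, inv_inv]
      have h0 := wl_gen (𝒬 : Set Q) s (Or.inl hs)
      have h1 := wl_gen (𝒬 : Set Q) s⁻¹ (Or.inr (by simpa using hs))
      have h2 := wl_mul _ h𝒬 s⁻¹ q
      refine ⟨s⁻¹ * q, (fs s (s⁻¹ * q))⁻¹, ?_, by omega, ?_⟩
      · have := hfs s (s⁻¹ * q)
        rw [mul_inv_cancel_left] at this
        rw [hx, map_inv, eq_mul_inv_iff_mul_eq, mul_assoc, ← this, inv_mul_cancel_left]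
      · have h3 : (wordLength (A : Set H) (fs s (s⁻¹ * q))⁻¹ : ℝ) ≤
            wordLength (A : Set H) (fs s (s⁻¹ * q)) := by
          exact_mod_cast wl_inv _ hA _
        exact h3.trans (hfsb s _ h0 (by omega))

/-- For a polynomial extension `1 → H → G → Q → 1`, the Schwartz space of `H` formed with
the word-length `ℓ_H` coincides with the one formed with the restriction to `H` of the
word-length `ℓ` of `G` (associated to the generating set `ι(A) ∪ σ(𝒬)`). -/
theorem schwartz_space_of_subgroup_eq
    {H G Q : Type*} [Group H] [Group G] [Group Q]
    (ι : H →* G) (π : G →* Q)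
    (hι : Function.Injective ι) (hπ : Function.Surjective π)
    (hexact : ι.range = π.ker)
    (σ : Q → G) (hσ : ∀ q, π (σ q) = q)
    (A : Finset H) (hA : Subgroup.closure (A : Set H) = ⊤)
    (𝒬 : Finset Q) (h𝒬 : Subgroup.closure (𝒬 : Set Q) = ⊤)
    (fs : Q → Q → H)
    (hfs : ∀ q₁ q₂, σ q₁ * σ q₂ = σ (q₁ * q₂) * ι (fs q₁ q₂))
    (conj : H → Q → H)
    (hconj : ∀ (h : H) (q : Q), ι (conj h q) = (σ q)⁻¹ * ι h * σ q)
    (C₀ r₀ : ℝ) (hC₀ : 0 < C₀) (hr₀ : 0 < r₀)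
    (hfs_poly : ∀ q₁ q₂ : Q,
      (wordLength (A : Set H) (fs q₁ q₂) : ℝ) ≤
        C₀ * ((1 + (wordLength (𝒬 : Set Q) q₁ : ℝ)) *
              (1 + (wordLength (𝒬 : Set Q) q₂ : ℝ))) ^ r₀)
    (hconj_poly : ∀ (h : H) (q : Q),
      (wordLength (A : Set H) (conj h q) : ℝ) ≤
        C₀ * (wordLength (A : Set H) h : ℝ) *
          (1 + (wordLength (𝒬 : Set Q) q : ℝ)) ^ r₀)
    (f : H → ℂ) :
    (∀ k : ℕ, Summable fun h : H =>
        ‖f h‖ * (1 + (wordLength (A : Set H) h : ℝ)) ^ k) ↔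
    (∀ k : ℕ, Summable fun h : H =>
        ‖f h‖ * (1 + (wordLength (ι '' (A : Set H) ∪ σ '' (𝒬 : Set Q)) (ι h) : ℝ)) ^ k) := by
  have hσ1 : σ 1 = ι (fs 1 1) := by
    have := hfs 1 1
    rw [mul_one] at this
    exact mul_left_cancel this
  have himg : ∀ h : H, ∃ w : List G, w.length = wordLength (A : Set H) h ∧
      (∀ x ∈ w, x ∈ ι '' (A : Set H) ∪ σ '' (𝒬 : Set Q) ∨
        x⁻¹ ∈ ι '' (A : Set H) ∪ σ '' (𝒬 : Set Q)) ∧ w.prod = ι h := by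
    intro h
    obtain ⟨v, hv, hv2, hv3⟩ := wl_exists _ hA h
    refine ⟨v.map ι, by simpa using hv, ?_, by rw [← hv3, map_list_prod]⟩
    intro x hx
    obtain ⟨y, hy, rfl⟩ := List.mem_map.1 hx
    rcases hv2 y hy with h | h
    · exact Or.inl (Or.inl ⟨y, h, rfl⟩)
    · exact Or.inr (Or.inl ⟨y⁻¹, h, map_inv _ _⟩)
  constructor
  · intro hs
    refine schwartz_dom f (fun h => wordLength (ι '' (A : Set H) ∪ σ '' (𝒬 : Set Q)) (ι h))
      (fun h => wordLength (A : Set H) h) 1 1 (fun h => ?_) hs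
    obtain ⟨w, hw, hw2, hw3⟩ := himg h
    have := wl_le _ w hw2
    rw [hw3, hw] at this
    have h2 : (wordLength (ι '' (A : Set H) ∪ σ '' (𝒬 : Set Q)) (ι h) : ℝ) ≤
      wordLength (A : Set H) h := by exact_mod_cast this
    rw [pow_one, one_mul]
    linarith
  · intro hs
    refine schwartz_dom f (fun h => wordLength (A : Set H) h)
      (fun h => wordLength (ι '' (A : Set H) ∪ σ '' (𝒬 : Set Q)) (ι h))
      (1 + 2 * wordLength (A : Set H) (fs 1 1) + C₀ * 2 ^ ⌈r₀⌉₊) (⌈r₀⌉₊ + 1) (fun h => ?_) hs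
    obtain ⟨w₀, -, hw₀, hp₀⟩ := himg h
    obtain ⟨w, hwl, hw, hwp⟩ := wl_attained _ w₀ hw₀
    rw [hp₀] at hwl hwp
    obtain ⟨q, h', hprod, -, hh⟩ := word_normal_form ι σ A hA 𝒬 h𝒬 fs hfs conj hconj C₀ r₀ hC₀ hr₀
      hfs_poly hconj_poly w.length w hw le_rfl
    have hπι : ∀ y, π (ι y) = 1 := fun y => by
      have : ι y ∈ π.ker := hexact ▸ ⟨y, rfl⟩
      exact this
    have hq : q = 1 := by
      have := congrArg π (hwp.symm.trans hprod)
      rw [map_mul, hπι, hπι, hσ, mul_one] at this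
      exact this.symm
    have hheq : h = fs 1 1 * h' := by
      apply hι
      rw [map_mul, ← hσ1, ← hwp, hprod, hq]
    have h1 : (wordLength (A : Set H) h : ℝ) ≤
        wordLength (A : Set H) (fs 1 1) + wordLength (A : Set H) h' := by
      rw [hheq]
      exact_mod_cast wl_mul _ hA _ _
    simp only [← hwl]
    set n : ℝ := (w.length : ℝ) with hn
    have hn0 : 0 ≤ n := Nat.cast_nonneg _
    set D : ℝ := (wordLength (A : Set H) (fs 1 1) : ℝ) with hD
    have hD0 : 0 ≤ D := Nat.cast_nonneg _
    have h2 : (2 * (1 + n)) ^ r₀ ≤ (2 * (1 + n)) ^ ⌈r₀⌉₊ := by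
      rw [← Real.rpow_natCast]
      exact Real.rpow_le_rpow_of_exponent_le (by linarith) (Nat.le_ceil _)
    have h3 : n * (C₀ * (2 * (1 + n)) ^ r₀) ≤ (1 + n) * (C₀ * (2 * (1 + n)) ^ ⌈r₀⌉₊) := by
      gcongr
      linarith
    have h4 : (1 + n) * (C₀ * (2 * (1 + n)) ^ ⌈r₀⌉₊) = C₀ * 2 ^ ⌈r₀⌉₊ * (1 + n) ^ (⌈r₀⌉₊ + 1) := by
      rw [mul_pow, pow_succ]; ring
    have h5 : 1 + 2 * D ≤ (1 + 2 * D) * (1 + n) ^ (⌈r₀⌉₊ + 1) :=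
      le_mul_of_one_le_right (by positivity) (one_le_pow₀ (by linarith))
    rw [add_mul]
    linarith
end

section
/- Let G be a countable group with length function ℓ, let n ≥ 2, and for φ : Gⁿ → ℂ define ‖φ‖_{1,k} = Σ_{(g₁,…,gₙ)∈Gⁿ} |φ(g₁,…,gₙ)|·∏_{i=1}^n (1+ℓ(gᵢ))^k. Suppose ‖φ‖_{1,k} < ∞ for all k ∈ ℕ. Define the bar differential δφ : G^{n−1} → ℂ by (δφ)(y₁,…,y_{n−1}) = Σ_{i=1}^{n} (−1)^i Σ_{g∈G} φ(y₁,…,y_{i−1}, g, y_i,…,y_{n−1}) (inserting g in the i-th slot). Then all the inner sums converge absolutely, δφ satisfies ‖δφ‖_{1,k} < ∞ for all k, and in fact ‖δφ‖_{1,k} ≤ n·‖φ‖_{1,k} for every k ∈ ℕ; i.e. δ is a bounded map on these weighted ℓ¹ spaces. -/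
/-- A length function on a group: it vanishes exactly at the identity, is symmetric under
inversion, and is subadditive. -/
def IsLengthFunction {G : Type*} [Group G] (ℓ : G → ℝ) : Prop :=
  (∀ g, 0 ≤ ℓ g) ∧ (∀ g, ℓ g = 0 ↔ g = 1) ∧ (∀ g, ℓ g⁻¹ = ℓ g) ∧
    ∀ g h, ℓ (g * h) ≤ ℓ g + ℓ h

/-- The bar differential on `(n+1)`-variable functions: all inner sums converge
absolutely, and `δ` is bounded with `‖δφ‖_{1,k} ≤ (n+1)·‖φ‖_{1,k}` on the weighted `ℓ¹`
norms of `S_ℓG^{⊗̂(n+1)}`.  (Here `φ` has `n+1 ≥ 2` variables and `δφ` has `n` variables.) -/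
theorem bar_differential_bounded
    {G : Type*} [Group G] [Countable G]
    (ℓ : G → ℝ) (hℓ : IsLengthFunction ℓ)
    (n : ℕ) (hn : 1 ≤ n)
    (φ : (Fin (n + 1) → G) → ℂ)
    (hφ : ∀ k : ℕ, Summable fun g : Fin (n + 1) → G =>
      ‖φ g‖ * ∏ i, (1 + ℓ (g i)) ^ k) :
    (∀ (y : Fin n → G) (i : Fin (n + 1)),
      Summable fun g : G => ‖φ (i.insertNth g y)‖) ∧
    ∀ k : ℕ,
      (Summable fun y : Fin n → G =>
        ‖∑ i : Fin (n + 1), (-1 : ℂ) ^ ((i : ℕ) + 1) * ∑' g : G, φ (i.insertNth g y)‖ *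
          ∏ j, (1 + ℓ (y j)) ^ k) ∧
      (∑' y : Fin n → G,
        ‖∑ i : Fin (n + 1), (-1 : ℂ) ^ ((i : ℕ) + 1) * ∑' g : G, φ (i.insertNth g y)‖ *
          ∏ j, (1 + ℓ (y j)) ^ k) ≤
        (n + 1) * ∑' g : Fin (n + 1) → G, ‖φ g‖ * ∏ i, (1 + ℓ (g i)) ^ k := by
  have hs : ∀ (k : ℕ) (i : Fin (n + 1)), Summable fun p : (Fin n → G) × G =>
      ‖φ (i.insertNth p.2 p.1)‖ * ∏ j, (1 + ℓ ((i.insertNth p.2 p.1 : Fin (n + 1) → G) j)) ^ k := by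
    intro k i
    exact (((Equiv.prodComm _ _).trans (Fin.insertNthEquiv (fun _ => G) i)).summable_iff
      (f := fun g : Fin (n + 1) → G => ‖φ g‖ * ∏ i, (1 + ℓ (g i)) ^ k)).2 (hφ k)
  have ht : ∀ (k : ℕ) (i : Fin (n + 1)), (∑' p : (Fin n → G) × G,
      ‖φ (i.insertNth p.2 p.1)‖ * ∏ j, (1 + ℓ ((i.insertNth p.2 p.1 : Fin (n + 1) → G) j)) ^ k)
      = ∑' g : Fin (n + 1) → G, ‖φ g‖ * ∏ i, (1 + ℓ (g i)) ^ k := by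
    intro k i
    exact ((Equiv.prodComm _ _).trans (Fin.insertNthEquiv (fun _ => G) i)).tsum_eq
      (fun g : Fin (n + 1) → G => ‖φ g‖ * ∏ i, (1 + ℓ (g i)) ^ k)
  have h1 : ∀ (y : Fin n → G) (i : Fin (n + 1)),
      Summable fun g : G => ‖φ (i.insertNth g y)‖ := by
    intro y i
    simpa using (hs 0 i).prod_factor y
  refine ⟨h1, fun k => ?_⟩
  have hW : ∀ y : Fin n → G, 0 ≤ ∏ j, (1 + ℓ (y j)) ^ k := fun y =>
    Finset.prod_nonneg fun j _ => pow_nonneg (by linarith [hℓ.1 (y j)]) k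
  have hle : ∀ (i : Fin (n + 1)) (y : Fin n → G) (g : G),
      ‖φ (i.insertNth g y)‖ * ∏ j, (1 + ℓ (y j)) ^ k ≤
      ‖φ (i.insertNth g y)‖ * ∏ j, (1 + ℓ ((i.insertNth g y : Fin (n + 1) → G) j)) ^ k := by
    intro i y g
    refine mul_le_mul_of_nonneg_left ?_ (norm_nonneg _)
    rw [Fin.prod_univ_succAbove _ i]
    simp only [Fin.insertNth_apply_same, Fin.insertNth_apply_succAbove]
    exact le_mul_of_one_le_left (hW y) (one_le_pow₀ (by linarith [hℓ.1 g]))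
  have hb : ∀ y : Fin n → G,
      ‖∑ i : Fin (n + 1), (-1 : ℂ) ^ ((i : ℕ) + 1) * ∑' g : G, φ (i.insertNth g y)‖ *
          ∏ j, (1 + ℓ (y j)) ^ k ≤
      ∑ i : Fin (n + 1), ∑' g : G, ‖φ (i.insertNth g y)‖ *
        ∏ j, (1 + ℓ ((i.insertNth g y : Fin (n + 1) → G) j)) ^ k := by
    intro y
    refine (mul_le_mul_of_nonneg_right (norm_sum_le _ _) (hW y)).trans ?_
    rw [Finset.sum_mul]
    refine Finset.sum_le_sum fun i _ => ?_
    rw [norm_mul, norm_pow, norm_neg, norm_one, one_pow, one_mul]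
    refine (mul_le_mul_of_nonneg_right (norm_tsum_le_tsum_norm (h1 y i)) (hW y)).trans ?_
    rw [← tsum_mul_right]
    exact ((h1 y i).mul_right _).tsum_le_tsum (hle i y) ((hs k i).prod_factor y)
  have hT : ∀ i ∈ (Finset.univ : Finset (Fin (n + 1))), Summable fun y : Fin n → G =>
      ∑' g : G, ‖φ (i.insertNth g y)‖ *
        ∏ j, (1 + ℓ ((i.insertNth g y : Fin (n + 1) → G) j)) ^ k :=
    fun i _ => (hs k i).prod
  have hS := summable_sum hT
  have hsum := Summable.of_nonneg_of_le
    (fun y => mul_nonneg (norm_nonneg _) (hW y)) hb hS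
  refine ⟨hsum, (hsum.tsum_le_tsum hb hS).trans ?_⟩
  rw [Summable.tsum_finsetSum hT]
  have hE : ∀ i : Fin (n + 1), (∑' y : Fin n → G, ∑' g : G, ‖φ (i.insertNth g y)‖ *
        ∏ j, (1 + ℓ ((i.insertNth g y : Fin (n + 1) → G) j)) ^ k) =
      ∑' g : Fin (n + 1) → G, ‖φ g‖ * ∏ i, (1 + ℓ (g i)) ^ k := by
    intro i
    rw [← ht k i, (hs k i).tsum_prod]
  rw [Finset.sum_congr rfl fun i _ => hE i]
  simp
end

section
/- Let (A, F, d) be a filtered differential graded module over a ring R. Then for all integers p, q, r one has Z_{r+1}^{p,q} ∩ (B_r^{p,q} + Z_{r−1}^{p+1,q−1}) = B_r^{p,q} + Z_r^{p+1,q−1} (as submodules of A^{p+q}). -/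
/-- `Z_r^{p,q} = F^pA^{p+q} ∩ d⁻¹(F^{p+r}A^{p+q+1})`, for a filtered differential graded
module realized inside a single module `M` with total differential `d` and filtration
`F p n` of the graded piece `A n`. -/
def Zsub {R M : Type*} [Ring R] [AddCommGroup M] [Module R M]
    (F : ℤ → ℤ → Submodule R M) (d : M →ₗ[R] M) (r p q : ℤ) : Submodule R M :=
  F p (p + q) ⊓ (F (p + r) (p + q + 1)).comap d

/-- `B_r^{p,q} = F^pA^{p+q} ∩ d(F^{p−r}A^{p+q−1})`. -/
def Bsub {R M : Type*} [Ring R] [AddCommGroup M] [Module R M]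
    (F : ℤ → ℤ → Submodule R M) (d : M →ₗ[R] M) (r p q : ℤ) : Submodule R M :=
  F p (p + q) ⊓ (F (p - r) (p + q - 1)).map d

/-- `Z_∞^{p,q} = F^pA^{p+q} ∩ ker d`. -/
def Zinf {R M : Type*} [Ring R] [AddCommGroup M] [Module R M]
    (F : ℤ → ℤ → Submodule R M) (d : M →ₗ[R] M) (p q : ℤ) : Submodule R M :=
  F p (p + q) ⊓ LinearMap.ker d

/-- `B_∞^{p,q} = F^pA^{p+q} ∩ d(A^{p+q−1})`. -/
def Binf {R M : Type*} [Ring R] [AddCommGroup M] [Module R M]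
    (A : ℤ → Submodule R M) (F : ℤ → ℤ → Submodule R M) (d : M →ₗ[R] M)
    (p q : ℤ) : Submodule R M :=
  F p (p + q) ⊓ (A (p + q - 1)).map d

/-- `Z_{r+1}^{p,q} ∩ (B_r^{p,q} + Z_{r−1}^{p+1,q−1}) = B_r^{p,q} + Z_r^{p+1,q−1}`. -/
theorem Zsub_inter_sum
    {R M : Type*} [Ring R] [AddCommGroup M] [Module R M]
    (A : ℤ → Submodule R M) (F : ℤ → ℤ → Submodule R M) (d : M →ₗ[R] M)
    (hd2 : ∀ x : M, d (d x) = 0)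
    (hFA : ∀ p n : ℤ, F p n ≤ A n)
    (hdA : ∀ n : ℤ, (A n).map d ≤ A (n + 1))
    (hFdec : ∀ p n : ℤ, F (p + 1) n ≤ F p n)
    (hdF : ∀ p n : ℤ, (F p n).map d ≤ F p (n + 1))
    (p q r : ℤ) :
    Zsub F d (r + 1) p q ⊓ (Bsub F d r p q ⊔ Zsub F d (r - 1) (p + 1) (q - 1)) =
      Bsub F d r p q ⊔ Zsub F d r (p + 1) (q - 1) := by
  have e1 : p + 1 + (q - 1) = p + q := by ring
  have e2 : p + 1 + r = p + (r + 1) := by ring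
  have e3 : p + 1 + (r - 1) = p + r := by ring
  have e4 : p + (r + 1) = p + r + 1 := by ring
  ext x
  simp only [Submodule.mem_inf, Submodule.mem_sup, Zsub, Bsub, Submodule.mem_comap,
    e1, e2, e3]
  constructor
  · rintro ⟨⟨_, hx2⟩, b, ⟨hb1, hb2⟩, z, ⟨hz1, _⟩, rfl⟩
    refine ⟨b, ⟨hb1, hb2⟩, z, ⟨hz1, ?_⟩, rfl⟩
    obtain ⟨c, _, rfl⟩ := hb2
    rwa [map_add, hd2, zero_add] at hx2
  · rintro ⟨b, ⟨hb1, hb2⟩, z, ⟨hz1, hz2⟩, rfl⟩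
    refine ⟨⟨add_mem hb1 (hFdec _ _ hz1), ?_⟩, b, ⟨hb1, hb2⟩, z, ⟨hz1, ?_⟩, rfl⟩
    · obtain ⟨c, _, rfl⟩ := hb2
      rwa [map_add, hd2, zero_add]
    · rw [e4] at hz2
      exact hFdec _ _ hz2
end

section
/- Let (A, F, d) be a filtered differential graded module over a ring R. Then for all integers p, q, r one has { z ∈ Z_r^{p,q} : d z ∈ Z_{r−1}^{p+r+1, q−r} + B_{r−1}^{p+r, q−r+1} } = Z_{r+1}^{p,q} + Z_{r−1}^{p+1,q−1}. (This identity computes the kernel of the induced differential d_r on the spectral sequence page E_r^{p,q} = Z_r^{p,q}/(Z_{r−1}^{p+1,q−1} + B_{r−1}^{p,q}).) -/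
/-- The kernel computation for the induced differential on `E_r^{p,q}`:
`{ z ∈ Z_r^{p,q} : d z ∈ Z_{r−1}^{p+r+1,q−r} + B_{r−1}^{p+r,q−r+1} }
  = Z_{r+1}^{p,q} + Z_{r−1}^{p+1,q−1}`. -/
theorem kernel_of_induced_differential
    {R M : Type*} [Ring R] [AddCommGroup M] [Module R M]
    (A : ℤ → Submodule R M) (F : ℤ → ℤ → Submodule R M) (d : M →ₗ[R] M)
    (hd2 : ∀ x : M, d (d x) = 0)
    (hFA : ∀ p n : ℤ, F p n ≤ A n)
    (hdA : ∀ n : ℤ, (A n).map d ≤ A (n + 1))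
    (hFdec : ∀ p n : ℤ, F (p + 1) n ≤ F p n)
    (hdF : ∀ p n : ℤ, (F p n).map d ≤ F p (n + 1))
    (p q r : ℤ) :
    Zsub F d r p q ⊓
        (Zsub F d (r - 1) (p + r + 1) (q - r) ⊔ Bsub F d (r - 1) (p + r) (q - r + 1)).comap d =
      Zsub F d (r + 1) p q ⊔ Zsub F d (r - 1) (p + 1) (q - 1) := by
  have eZ : ∀ s a b n a' : ℤ, a + b = n → a + s = a' → ∀ x : M,
      x ∈ Zsub F d s a b ↔ x ∈ F a n ∧ d x ∈ F a' (n + 1) := by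
    rintro s a b n a' rfl rfl x
    exact Iff.rfl
  have eB : ∀ s a b n a' : ℤ, a + b = n + 1 → a - s = a' → ∀ x : M,
      x ∈ Bsub F d s a b ↔ x ∈ F a (n + 1) ∧ ∃ w ∈ F a' n, d w = x := by
    rintro s a b n a' h rfl x
    obtain rfl : n = a + b - 1 := by omega
    rw [← h]
    exact Iff.rfl
  have e1 := eZ r p q (p + q) (p + r) rfl rfl
  have e2 := eZ (r - 1) (p + r + 1) (q - r) (p + q + 1) (p + r + 1 + (r - 1)) (by ring) rfl
  have e3 := eB (r - 1) (p + r) (q - r + 1) (p + q) (p + 1) (by ring) (by ring)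
  have e4 := eZ (r + 1) p q (p + q) (p + r + 1) rfl (by ring)
  have e5 := eZ (r - 1) (p + 1) (q - 1) (p + q) (p + r) (by ring) (by ring)
  ext z
  rw [Submodule.mem_inf, Submodule.mem_comap, Submodule.mem_sup, Submodule.mem_sup, e1]
  constructor
  · rintro ⟨⟨hz, hdz⟩, u, hu, v, hv, huv⟩
    obtain ⟨hv, w, hw, rfl⟩ := (e3 v).1 hv
    refine ⟨z - w, (e4 _).2 ⟨sub_mem hz (hFdec _ _ hw), ?_⟩, w, (e5 _).2 ⟨hw, hv⟩,
      sub_add_cancel z w⟩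
    rw [map_sub, ← huv, add_sub_cancel_right]
    exact ((e2 u).1 hu).1
  · rintro ⟨x, hx, w, hw, rfl⟩
    obtain ⟨hx, hdx⟩ := (e4 x).1 hx
    obtain ⟨hw, hdw⟩ := (e5 w).1 hw
    refine ⟨⟨add_mem hx (hFdec _ _ hw), ?_⟩, d x, (e2 _).2 ⟨hdx, ?_⟩, d w,
      (e3 _).2 ⟨hdw, w, hw, rfl⟩, (map_add d x w).symm⟩
    · rw [map_add]
      exact add_mem (hFdec _ _ hdx) hdw
    · rw [hd2]
      exact zero_mem _
end
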